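/- arXiv:math/9801054 — 2 statements merged into one kernel-verified Lean document; each statement's English description precedes it below -/
import Mathlib

section
/- Let X be a compact topological space and F : X × [0,1] → ℝ a continuous function such that m(t) := max_{x ∈ X} |F(x,t)| > 0 for every t ∈ [0,1]. Then there exists a continuously differentiable strictly increasing bijection a : [0,1] → [0,1] with a(0) = 0 and a(1) = 1 such that sup_{(x,s) ∈ X × [0,1]} |a'(s) · F(x, a(s))| = ∫₀¹ max_{x ∈ X} |F(x,t)| dt. -/
/-- The fibrewise supremum of a continuous function over a compact space is continuous. -/
lemma continuous_iSup_of_compactSpace {X Y : Type*} [TopologicalSpace X] [CompactSpace X]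
    [TopologicalSpace Y] {f : Y → X → ℝ} (hf : Continuous (Function.uncurry f)) :
    Continuous fun y => ⨆ x, f y x := by
  simpa only [Set.image_univ, sSup_range] using isCompact_univ.continuous_sSup hf

/-- A primitive of a continuous function bounded below by a positive constant is an order
isomorphism of the real line. -/
lemma exists_orderIso_hasDerivAt {M : ℝ → ℝ} (hM : Continuous M) {c : ℝ} (hc : 0 < c)
    (hcM : ∀ t, c ≤ M t) :
    ∃ e : ℝ ≃o ℝ, (∀ t, HasDerivAt e (M t) t) ∧ ∀ t, e t = ∫ u in (0:ℝ)..t, M u := by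
  set b : ℝ → ℝ := fun t => ∫ u in (0:ℝ)..t, M u with hb
  have hderiv : ∀ t, HasDerivAt b (M t) t := fun t => hM.integral_hasStrictDerivAt 0 t |>.hasDerivAt
  have hb0 : b 0 = 0 := by simp [hb]
  have hstrict : StrictMono b := strictMono_of_deriv_pos fun t => by
    rw [(hderiv t).deriv]; exact hc.trans_le (hcM t)
  have hmono : Monotone fun t => b t - c * t := by
    have hd : ∀ t, HasDerivAt (fun t => b t - c * t) (M t - c) t := fun t =>
      ((hderiv t).sub ((hasDerivAt_id t).const_mul c)).congr_deriv (by rw [mul_one])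
    refine monotone_of_deriv_nonneg (fun t => (hd t).differentiableAt) fun t => ?_
    rw [(hd t).deriv]
    exact sub_nonneg.2 (hcM t)
  have hsurj : Function.Surjective b := by
    refine Continuous.surjective
      (continuous_iff_continuousAt.2 fun t => (hderiv t).continuousAt) ?_ ?_
    · refine Filter.tendsto_atTop_mono' _ ?_ (Filter.tendsto_id.const_mul_atTop hc)
      filter_upwards [Filter.eventually_ge_atTop 0] with t ht
      have := hmono ht
      simp only [hb0, id] at *
      linarith
    · refine Filter.tendsto_atBot_mono' _ ?_ (Filter.tendsto_id.const_mul_atBot hc)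
      filter_upwards [Filter.eventually_le_atBot 0] with t ht
      have := hmono ht
      simp only [hb0, id] at *
      linarith
  exact ⟨hstrict.orderIsoOfSurjective b hsurj, hderiv, fun _ => rfl⟩

/-- The analytic core of Lemma 2.A: for a compact space `X` and a continuous
`F : X × [0,1] → ℝ` with `m t := max_{x} |F (x, t)| > 0` for all `t ∈ [0,1]`, there is a
continuously differentiable strictly increasing bijection `a : [0,1] → [0,1]`, `a 0 = 0`,
`a 1 = 1`, such that the sup-norm of the reparametrized Hamiltonian
`(x, s) ↦ a' s * F (x, a s)` equals `∫₀¹ max_x |F (x, t)| dt`. -/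
theorem exists_reparametrization_sup_eq_integral
    {X : Type*} [TopologicalSpace X] [CompactSpace X] [Nonempty X]
    (F : X × ℝ → ℝ)
    (hF : ContinuousOn F (Set.univ ×ˢ Set.Icc 0 1))
    (hpos : ∀ t ∈ Set.Icc (0:ℝ) 1, 0 < ⨆ x : X, |F (x, t)|) :
    ∃ a a' : ℝ → ℝ,
      (∀ s ∈ Set.Icc (0:ℝ) 1, HasDerivWithinAt a (a' s) (Set.Icc 0 1) s) ∧
      ContinuousOn a' (Set.Icc 0 1) ∧
      StrictMonoOn a (Set.Icc 0 1) ∧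
      Set.BijOn a (Set.Icc 0 1) (Set.Icc 0 1) ∧
      a 0 = 0 ∧ a 1 = 1 ∧
      sSup ((fun p : X × ℝ => |a' p.2 * F (p.1, a p.2)|) '' (Set.univ ×ˢ Set.Icc 0 1))
        = ∫ t in (0:ℝ)..1, ⨆ x : X, |F (x, t)| := by
  set m : ℝ → ℝ := fun t => ⨆ x : X, |F (x, t)| with hm
  have h01 : (0:ℝ) ≤ 1 := zero_le_one
  have hG : Continuous fun p : Set.Icc (0:ℝ) 1 × X => F (p.2, p.1) :=
    hF.comp_continuous (by fun_prop) fun p => ⟨trivial, p.1.2⟩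
  have hmc : Continuous fun t : Set.Icc (0:ℝ) 1 => m t :=
    continuous_iSup_of_compactSpace (f := fun (t : Set.Icc (0:ℝ) 1) x => |F (x, t)|) hG.abs
  have hFx : ∀ t ∈ Set.Icc (0:ℝ) 1, Continuous fun x => |F (x, t)| := fun t ht =>
    (hG.comp (Continuous.prodMk_right (⟨t, ht⟩ : Set.Icc (0:ℝ) 1))).abs
  have hle : ∀ t ∈ Set.Icc (0:ℝ) 1, ∀ x, |F (x, t)| ≤ m t := fun t ht x =>
    le_ciSup (isCompact_range (hFx t ht)).bddAbove x
  obtain ⟨x₀, hx₀⟩ : ∃ x, |F (x, 0)| = m 0 :=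
    (isCompact_range (hFx 0 (by simp))).sSup_mem (Set.range_nonempty _)
  set M : ℝ → ℝ := Set.IccExtend h01 fun t => m t with hMdef
  have hMc : Continuous M := hmc.Icc_extend'
  have hMm : ∀ t ∈ Set.Icc (0:ℝ) 1, M t = m t := fun t ht => Set.IccExtend_of_mem _ _ ht
  obtain ⟨t₀, -, ht₀⟩ := isCompact_univ.exists_isMinOn Set.univ_nonempty hmc.continuousOn
  obtain ⟨e, he, heM⟩ := exists_orderIso_hasDerivAt hMc (hpos t₀ t₀.2)
    fun t => ht₀ (Set.mem_univ (Set.projIcc 0 1 h01 t))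
  have hMpos : ∀ t, 0 < M t := fun t => hpos _ (Set.projIcc 0 1 h01 t).2
  set C : ℝ := ∫ t in (0:ℝ)..1, m t with hC
  have he0 : e 0 = 0 := by simp [heM]
  have he1 : e 1 = C := by
    rw [heM]
    refine intervalIntegral.integral_congr fun t ht => hMm t ?_
    rwa [Set.uIcc_of_le h01] at ht
  have hCpos : 0 < C := by
    rw [← he0, ← he1]; exact e.strictMono zero_lt_one
  set a : ℝ → ℝ := fun s => e.symm (C * s) with ha
  have ha0 : a 0 = 0 := by simp [ha, e.symm_apply_eq, he0]
  have ha1 : a 1 = 1 := by simp [ha, e.symm_apply_eq, he1]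
  have hamono : StrictMono a := fun s t hst => e.symm.strictMono (by gcongr)
  have hac : Continuous a := e.symm.continuous.comp (by fun_prop)
  have hmaps : Set.MapsTo a (Set.Icc 0 1) (Set.Icc 0 1) := fun s hs =>
    ⟨ha0 ▸ hamono.monotone hs.1, ha1 ▸ hamono.monotone hs.2⟩
  refine ⟨a, fun s => C / M (a s), fun s _ => ?_, ?_, hamono.strictMonoOn _,
    ⟨hmaps, hamono.injective.injOn, ?_⟩, ha0, ha1, ?_⟩
  · have h1 : HasDerivAt e.symm (M (a s))⁻¹ (C * s) :=
      HasDerivAt.of_local_left_inverse e.symm.continuous.continuousAt (he _) (hMpos _).ne'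
        (Filter.Eventually.of_forall e.apply_symm_apply)
    have h2 := h1.comp s ((hasDerivAt_id s).const_mul C)
    rw [mul_one, inv_mul_eq_div] at h2
    exact h2.hasDerivWithinAt
  · exact (continuous_const.div (hMc.comp hac) fun s => (hMpos _).ne').continuousOn
  · have := intermediate_value_Icc h01 hac.continuousOn
    rwa [ha0, ha1] at this
  · refine IsGreatest.csSup_eq ⟨⟨(x₀, 0), by simp, ?_⟩, ?_⟩
    · have h0 := hMm 0 (by simp)
      have := hMpos 0
      simp only [ha0, abs_mul, hx₀, abs_div, abs_of_pos hCpos, abs_of_pos this, ← h0]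
      field_simp
    · rintro _ ⟨⟨x, s⟩, ⟨-, hs⟩, rfl⟩
      have hM := hMpos (a s)
      simp only [abs_mul, abs_div, abs_of_pos hCpos, abs_of_pos hM]
      calc C / M (a s) * |F (x, a s)| ≤ C / M (a s) * M (a s) := by
            gcongr
            rw [hMm _ (hmaps hs)]
            exact hle _ (hmaps hs) x
        _ = C := div_mul_cancel₀ _ hM.ne'
end

section
/- Let S² be the unit sphere in ℝ³ equipped with a finite Borel measure μ of full support (for instance the 2-dimensional surface/Hausdorff measure). Let L₁ and L₂ be compact connected subsets of S², each of μ-measure zero, such that for i = 1, 2 the complement S² ∖ Lᵢ has exactly two connected components, each of measure μ(S²)/2, and Lᵢ equals the topological frontier of each of the two components of its complement. Then L₁ ∩ L₂ ≠ ∅. -/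
open MeasureTheory

/-- The set of connected components of a subset `s` of a topological space. -/
def connComponentsIn {α : Type*} [TopologicalSpace α] (s : Set α) : Set (Set α) :=
  {C | ∃ x ∈ s, C = connectedComponentIn s x}

/-- An "equator-like" subset of the sphere `S²` (with respect to a finite Borel measure
`μ` of full support): a compact connected set of measure zero whose complement has
exactly two connected components, each of measure `μ(S²)/2`, and which is the frontier
of each of these components. -/
def IsEquatorLike (μ : Measure ↥(Metric.sphere (0 : EuclideanSpace ℝ (Fin 3)) 1))
    (L : Set ↥(Metric.sphere (0 : EuclideanSpace ℝ (Fin 3)) 1)) : Prop :=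
  IsCompact L ∧ IsConnected L ∧ μ L = 0 ∧
    ∃ U V, U ≠ V ∧ connComponentsIn Lᶜ = {U, V} ∧
      μ U = μ Set.univ / 2 ∧ μ V = μ Set.univ / 2 ∧
      L = frontier U ∧ L = frontier V

/-- The component of any point off an equator-like set has half the total measure, and the
set is its frontier. -/
lemma IsEquatorLike.component
    {μ : Measure ↥(Metric.sphere (0 : EuclideanSpace ℝ (Fin 3)) 1)}
    {L : Set ↥(Metric.sphere (0 : EuclideanSpace ℝ (Fin 3)) 1)} (h : IsEquatorLike μ L)
    {x : ↥(Metric.sphere (0 : EuclideanSpace ℝ (Fin 3)) 1)} (hx : x ∈ Lᶜ) :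
    μ (connectedComponentIn Lᶜ x) = μ Set.univ / 2 ∧
      frontier (connectedComponentIn Lᶜ x) = L := by
  obtain ⟨-, -, -, U, V, -, hUV, hU, hV, hLU, hLV⟩ := h
  have hmem : connectedComponentIn Lᶜ x ∈ ({U, V} : Set (Set _)) := hUV ▸ ⟨x, hx, rfl⟩
  rcases hmem with h | h
  · rw [h]
    exact ⟨hU, hLU.symm⟩
  · rw [h]
    exact ⟨hV, hLV.symm⟩

/-- An equator-like set has a complementary component different from any given set. -/
lemma IsEquatorLike.exists_component_ne
    {μ : Measure ↥(Metric.sphere (0 : EuclideanSpace ℝ (Fin 3)) 1)}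
    {L : Set ↥(Metric.sphere (0 : EuclideanSpace ℝ (Fin 3)) 1)} (h : IsEquatorLike μ L)
    (A : Set ↥(Metric.sphere (0 : EuclideanSpace ℝ (Fin 3)) 1)) :
    ∃ y ∈ Lᶜ, connectedComponentIn Lᶜ y ≠ A := by
  obtain ⟨-, -, -, U, V, hne, hUV, -⟩ := h
  obtain ⟨x, hx, rfl⟩ : U ∈ connComponentsIn Lᶜ := hUV ▸ Or.inl rfl
  obtain ⟨y, hy, rfl⟩ : V ∈ connComponentsIn Lᶜ := hUV ▸ Or.inr rfl
  by_cases hxA : connectedComponentIn Lᶜ x = A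
  · exact ⟨y, hy, fun hyA => hne (hxA.trans hyA.symm)⟩
  · exact ⟨x, hx, hxA⟩

/-- An open set equals any closed subset of it of at least the same measure. -/
lemma IsOpen.eq_of_isClosed_subset_of_measure_le {X : Type*} [TopologicalSpace X]
    [MeasurableSpace X] [OpensMeasurableSpace X] {μ : Measure X} [IsFiniteMeasure μ]
    [μ.IsOpenPosMeasure] {C K : Set X} (hC : IsOpen C) (hK : IsClosed K) (hKC : K ⊆ C)
    (hμ : μ C ≤ μ K) : C = K := by
  have hzero : μ (C \ K) = 0 := by
    rw [measure_sdiff hKC hK.measurableSet.nullMeasurableSet (measure_ne_top μ K)]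
    exact tsub_eq_zero_of_le hμ
  have hempty : C \ K = ∅ := (hC.sdiff hK).measure_eq_zero_iff μ |>.mp hzero
  exact (Set.sdiff_eq_empty.mp hempty).antisymm hKC

/-- Two subsets of the unit sphere `S² ⊆ ℝ³`, each of which is a compact connected set
of measure zero dividing the sphere into two connected components of equal (half the
total) measure and equal to the frontier of each of these components, must intersect.
Here `μ` is any finite Borel measure of full support on `S²`. -/
theorem equators_intersect
    (μ : Measure ↥(Metric.sphere (0 : EuclideanSpace ℝ (Fin 3)) 1))
    [IsFiniteMeasure μ] [μ.IsOpenPosMeasure]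
    (L₁ L₂ : Set ↥(Metric.sphere (0 : EuclideanSpace ℝ (Fin 3)) 1))
    (h₁ : IsEquatorLike μ L₁) (h₂ : IsEquatorLike μ L₂) :
    (L₁ ∩ L₂).Nonempty := by
  by_contra hdisj
  rw [Set.not_nonempty_iff_eq_empty, ← Set.disjoint_iff_inter_eq_empty] at hdisj
  obtain ⟨q, hq⟩ := h₂.2.1.nonempty
  have hL₂ : L₂ ⊆ connectedComponentIn L₁ᶜ q :=
    h₂.2.1.isPreconnected.subset_connectedComponentIn hq hdisj.subset_compl_left
  obtain ⟨y, hy, hyq⟩ := h₁.exists_component_ne (connectedComponentIn L₁ᶜ q)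
  obtain ⟨hBμ, hBL⟩ := h₁.component hy
  set B := connectedComponentIn L₁ᶜ y with hB
  have hclosure : closure B = B ∪ L₁ := by rw [closure_eq_self_union_frontier, hBL]
  have hBL₂ : closure B ⊆ L₂ᶜ := by
    intro z hz hz₂
    rw [hclosure] at hz
    rcases hz with hzB | hz₁
    · exact hyq ((connectedComponentIn_eq hzB).trans (connectedComponentIn_eq (hL₂ hz₂)).symm)
    · exact hdisj.le_bot ⟨hz₁, hz₂⟩
  have hyB : y ∈ closure B := subset_closure (mem_connectedComponentIn hy)
  obtain ⟨hCμ, hCL⟩ := h₂.component (hBL₂ hyB)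
  set C := connectedComponentIn L₂ᶜ y with hC
  have hBC : closure B ⊆ C :=
    isPreconnected_connectedComponentIn.closure.subset_connectedComponentIn hyB hBL₂
  have hCopen : IsOpen C := by
    rw [← disjoint_frontier_iff_isOpen, hCL]
    exact Set.subset_compl_iff_disjoint_left.mp (connectedComponentIn_subset L₂ᶜ y)
  have hCB : C = closure B := hCopen.eq_of_isClosed_subset_of_measure_le (μ := μ)
    isClosed_closure hBC (by rw [hCμ, ← hBμ]; exact measure_mono subset_closure)
  have hclopen : IsClopen C := ⟨hCB ▸ isClosed_closure, hCopen⟩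
  rw [← hCL, hclopen.frontier_eq] at hq
  exact hq
end
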